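/- High-Rank Preheating: fix an integer k with r ≤ k ≤ b, let Û be a Haar-random b×b orthogonal matrix, and let B̂_0 ∈ ℝ^{b×k} consist of the first k columns of Û. Run the rank-k Asymmetric LoRA gradient flow with LSI (Â_0 = 0 ∈ ℝ^{a×k}, B̂_0 frozen) for matrix factorization for an arbitrary time t > 0, producing X̂_t = (α/k)B̂_tÂ_tᵀ. Assume that almost surely σ_r(X̂_t) > σ_{r+1}(X̂_t), and let A_0 ∈ ℝ^{a×r} have columns equal to orthonormal right singular vectors of X̂_t corresponding to its r largest singular values. Then the rank-r Asymmetric LoRA gradient flow with RSI initialized at this A_0 (B_0 = 0) converges as s → ∞ to a limit X_∞, and E_Û[(1/2)‖X_∞ − M‖_F²] ≤ Σ_{i=r+1}^{k} σ_i(M)² + ((b−k)/(2b))·Σ_{i=1}^{min(a,b)} σ_i(M)². -/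

import Mathlib

open Matrix MeasureTheory Filter Topology

noncomputable section

/-- The measurable space structure on matrices (the product σ-algebra). -/
instance matrixMeasurableSpace {m n : Type*} : MeasurableSpace (Matrix m n ℝ) :=
  show MeasurableSpace (m → n → ℝ) from inferInstance

/-- Squared Frobenius norm of a real matrix. -/
def fnormSq {m n : ℕ} (M : Matrix (Fin m) (Fin n) ℝ) : ℝ := ∑ i, ∑ j, M i j ^ 2

/-- Frobenius norm of a real matrix. -/
def fnorm {m n : ℕ} (M : Matrix (Fin m) (Fin n) ℝ) : ℝ := Real.sqrt (fnormSq M)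

/-- `X = (α/r) • B Aᵀ`, the LoRA update associated with adapters `A`, `B`. -/
def lX {a b r : ℕ} (α : ℝ) (A : Matrix (Fin a) (Fin r) ℝ) (B : Matrix (Fin b) (Fin r) ℝ) :
    Matrix (Fin b) (Fin a) ℝ := (α / (r : ℝ)) • (B * Aᵀ)

/-- `Y = (α/r) • A Aᵀ`. -/
def lY {a r : ℕ} (α : ℝ) (A : Matrix (Fin a) (Fin r) ℝ) : Matrix (Fin a) (Fin a) ℝ :=
  (α / (r : ℝ)) • (A * Aᵀ)

/-- `Z = (α/r) • B Bᵀ`. -/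
def lZ {b r : ℕ} (α : ℝ) (B : Matrix (Fin b) (Fin r) ℝ) : Matrix (Fin b) (Fin b) ℝ :=
  (α / (r : ℝ)) • (B * Bᵀ)

/-- `G = (α/r) • (X - M)`, the gradient of the matrix-factorization loss. -/
def lG {a b r : ℕ} (α : ℝ) (M : Matrix (Fin b) (Fin a) ℝ) (A : Matrix (Fin a) (Fin r) ℝ)
    (B : Matrix (Fin b) (Fin r) ℝ) : Matrix (Fin b) (Fin a) ℝ :=
  (α / (r : ℝ)) • (lX α A B - M)

/-- The LoRA gradient flow on `[0, ∞)` for the matrix-factorization objective, with learning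
rates `ηA` for the adapter `A` and `ηB` for the adapter `B`:
`dA/dt = -ηA Gᵀ B`, `dB/dt = -ηB G A`, stated entrywise. -/
def LoraFlow {a b r : ℕ} (α ηA ηB : ℝ) (M : Matrix (Fin b) (Fin a) ℝ)
    (A : ℝ → Matrix (Fin a) (Fin r) ℝ) (B : ℝ → Matrix (Fin b) (Fin r) ℝ) : Prop :=
  ∀ t, (0 : ℝ) ≤ t →
    (∀ i j, HasDerivAt (fun s => A s i j) (((-ηA) • ((lG α M (A t) (B t))ᵀ * B t)) i j) t) ∧
    (∀ i j, HasDerivAt (fun s => B s i j) (((-ηB) • (lG α M (A t) (B t) * A t)) i j) t)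

/-- The rectangular `b × a` diagonal matrix with diagonal entries `σ 0, σ 1, …`. -/
def svdDiag (b a : ℕ) (σ : ℕ → ℝ) : Matrix (Fin b) (Fin a) ℝ :=
  Matrix.of fun i j => if (i : ℕ) = (j : ℕ) then σ (i : ℕ) else 0

/-- `M = U Σ Vᵀ` is a singular value decomposition of `M` with (nonincreasing, nonnegative)
singular values `σ 0 ≥ σ 1 ≥ …`, so that `σ i` is the `(i+1)`-th largest singular value,
the columns of `U` are corresponding left singular vectors and the columns of `V` are
corresponding right singular vectors. -/
def IsSVD {b a : ℕ} (M : Matrix (Fin b) (Fin a) ℝ) (U : Matrix (Fin b) (Fin b) ℝ)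
    (V : Matrix (Fin a) (Fin a) ℝ) (σ : ℕ → ℝ) : Prop :=
  U * Uᵀ = 1 ∧ Uᵀ * U = 1 ∧ V * Vᵀ = 1 ∧ Vᵀ * V = 1 ∧
    (∀ i j, i ≤ j → σ j ≤ σ i) ∧ (∀ i, 0 ≤ σ i) ∧ (∀ i, min a b ≤ i → σ i = 0) ∧
    M = U * svdDiag b a σ * Vᵀ

theorem ode_scalar (f : ℝ → ℝ) (lam m : ℝ)
    (h : ∀ t, 0 ≤ t → HasDerivAt f (-lam * (f t - m)) t) (t : ℝ) (ht : 0 ≤ t) :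
    f t = m + (f 0 - m) * Real.exp (-lam * t) := by
  have hg : ∀ s, 0 ≤ s → HasDerivAt (fun s => (f s - m) * Real.exp (lam * s)) 0 s := by
    intro s hs
    have h1 := (h s hs).sub_const m
    have h2 : HasDerivAt (fun s => Real.exp (lam * s)) (Real.exp (lam * s) * (lam * 1)) s :=
      ((hasDerivAt_id s).const_mul lam).exp
    exact (h1.mul h2).congr_deriv (by ring)
  have hc := constant_of_has_deriv_right_zero (a := 0) (b := t)
    (f := fun s => (f s - m) * Real.exp (lam * s))
    (fun s hs => (hg s hs.1).continuousAt.continuousWithinAt)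
    (fun s hs => (hg s hs.1).hasDerivWithinAt) t ⟨ht, le_refl _⟩
  simp only [mul_zero, Real.exp_zero, mul_one] at hc
  rw [← hc, mul_assoc, ← Real.exp_add]
  simp

theorem fnormSq_eq_trace {m n : ℕ} (N : Matrix (Fin m) (Fin n) ℝ) :
    fnormSq N = (Nᵀ * N).trace := by
  simp only [fnormSq, Matrix.trace, Matrix.diag, Matrix.mul_apply, Matrix.transpose_apply]
  rw [Finset.sum_comm]
  simp only [sq]

theorem fnormSq_nonneg {m n : ℕ} (N : Matrix (Fin m) (Fin n) ℝ) : 0 ≤ fnormSq N :=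
  Finset.sum_nonneg fun _ _ => Finset.sum_nonneg fun _ _ => sq_nonneg _

theorem fnormSq_transpose {m n : ℕ} (N : Matrix (Fin m) (Fin n) ℝ) :
    fnormSq Nᵀ = fnormSq N := by
  simp only [fnormSq, Matrix.transpose_apply]
  rw [Finset.sum_comm]

theorem fnormSq_smul {m n : ℕ} (c : ℝ) (N : Matrix (Fin m) (Fin n) ℝ) :
    fnormSq (c • N) = c ^ 2 * fnormSq N := by
  simp only [fnormSq, Matrix.smul_apply, smul_eq_mul, mul_pow, Finset.mul_sum]

theorem fnormSq_isom {m n p : ℕ} (B : Matrix (Fin m) (Fin p) ℝ) (hB : Bᵀ * B = 1)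
    (N : Matrix (Fin p) (Fin n) ℝ) : fnormSq (B * N) = fnormSq N := by
  rw [fnormSq_eq_trace, fnormSq_eq_trace, Matrix.transpose_mul, Matrix.mul_assoc,
    ← Matrix.mul_assoc Bᵀ, hB, Matrix.one_mul]

theorem pyth_left {m n p : ℕ} (B : Matrix (Fin m) (Fin p) ℝ) (hB : Bᵀ * B = 1)
    (N : Matrix (Fin m) (Fin n) ℝ) :
    fnormSq (N - B * (Bᵀ * N)) = fnormSq N - fnormSq (Bᵀ * N) := by
  have h : (N - B * (Bᵀ * N))ᵀ * (N - B * (Bᵀ * N)) = Nᵀ * N - (Bᵀ * N)ᵀ * (Bᵀ * N) := by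
    simp only [Matrix.transpose_sub, Matrix.transpose_mul, Matrix.transpose_transpose,
      Matrix.sub_mul, Matrix.mul_sub, Matrix.mul_assoc]
    rw [← Matrix.mul_assoc Bᵀ B, hB, Matrix.one_mul]
    abel
  rw [fnormSq_eq_trace, h, Matrix.trace_sub, ← fnormSq_eq_trace, ← fnormSq_eq_trace]

theorem pyth_right {m n p : ℕ} (A : Matrix (Fin n) (Fin p) ℝ) (hA : Aᵀ * A = 1)
    (N : Matrix (Fin m) (Fin n) ℝ) :
    fnormSq (N - N * A * Aᵀ) = fnormSq N - fnormSq (N * A) := by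
  have h := pyth_left A hA Nᵀ
  rw [← fnormSq_transpose, ← fnormSq_transpose N, ← fnormSq_transpose (N * A)]
  simpa [Matrix.transpose_mul, Matrix.mul_assoc] using h

/-- first `n` columns -/
def firstCols {b a n : ℕ} (V : Matrix (Fin b) (Fin a) ℝ) (h : n ≤ a) : Matrix (Fin b) (Fin n) ℝ :=
  Matrix.of (fun i j => V i (Fin.castLE h j))

theorem firstCols_gram {b a n : ℕ} (V : Matrix (Fin b) (Fin a) ℝ) (h : n ≤ a) (d : ℕ → ℝ)
    (hV : Vᵀ * V = Matrix.diagonal (fun j : Fin a => d j)) :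
    (firstCols V h)ᵀ * firstCols V h = Matrix.diagonal (fun j : Fin n => d j) := by
  ext i j
  have := congrFun (congrFun hV (Fin.castLE h i)) (Fin.castLE h j)
  simp only [Matrix.mul_apply, Matrix.transpose_apply, firstCols, Matrix.of_apply,
    Matrix.diagonal_apply, Fin.val_castLE] at this ⊢
  rw [this]
  simp [Fin.ext_iff]

theorem firstCols_orth {b a n : ℕ} (V : Matrix (Fin b) (Fin a) ℝ) (h : n ≤ a)
    (hV : Vᵀ * V = 1) : (firstCols V h)ᵀ * firstCols V h = 1 := by
  have := firstCols_gram V h (fun _ => 1) (by rw [hV]; exact Matrix.diagonal_one.symm)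
  rw [this]; exact Matrix.diagonal_one

theorem mul_firstCols {c b a n : ℕ} (X : Matrix (Fin c) (Fin b) ℝ) (V : Matrix (Fin b) (Fin a) ℝ)
    (h : n ≤ a) : X * firstCols V h = firstCols (X * V) h := by
  ext i j
  simp [firstCols, Matrix.mul_apply]

theorem svdDiag_gram (b a : ℕ) (σ : ℕ → ℝ) (hσ : ∀ i, min a b ≤ i → σ i = 0) :
    (svdDiag b a σ)ᵀ * svdDiag b a σ = Matrix.diagonal (fun j : Fin a => σ j ^ 2) := by
  ext i j
  simp only [Matrix.mul_apply, Matrix.transpose_apply, svdDiag, Matrix.of_apply,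
    Matrix.diagonal_apply]
  by_cases hi : (i : ℕ) < b
  · rw [Finset.sum_eq_single (⟨i, hi⟩ : Fin b)]
    · simp only [if_true]
      by_cases hij : i = j
      · simp [hij, sq]
      · have : (i : ℕ) ≠ j := fun h => hij (Fin.ext h)
        simp [hij, this]
    · intro x _ hx
      have : (x : ℕ) ≠ i := fun h => hx (Fin.ext h)
      simp [this]
    · simp
  · have h0 : σ i = 0 := hσ i (le_trans (min_le_right _ _) (not_lt.mp hi))
    rw [Finset.sum_eq_zero]
    · simp [h0]
    · intro x _
      have : (x : ℕ) ≠ i := by have := x.2; omega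
      simp [this]

theorem svd_gram {b a : ℕ} {X : Matrix (Fin b) (Fin a) ℝ} {U : Matrix (Fin b) (Fin b) ℝ}
    {V : Matrix (Fin a) (Fin a) ℝ} {σ : ℕ → ℝ} (h : IsSVD X U V σ) :
    (X * V)ᵀ * (X * V) = Matrix.diagonal (fun j : Fin a => σ j ^ 2) := by
  obtain ⟨_, hU, _, hV, _, _, hσ, hX⟩ := h
  have : X * V = U * svdDiag b a σ := by
    rw [hX, Matrix.mul_assoc, hV, Matrix.mul_one]
  rw [this, Matrix.transpose_mul, Matrix.mul_assoc, ← Matrix.mul_assoc Uᵀ, hU, Matrix.one_mul,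
    svdDiag_gram b a σ hσ]

theorem svd_fnormSq_firstCols {b a n : ℕ} {X : Matrix (Fin b) (Fin a) ℝ}
    {U : Matrix (Fin b) (Fin b) ℝ}
    {V : Matrix (Fin a) (Fin a) ℝ} {σ : ℕ → ℝ} (h : IsSVD X U V σ) (hn : n ≤ a) :
    fnormSq (X * firstCols V hn) = ∑ i ∈ Finset.range n, σ i ^ 2 := by
  rw [mul_firstCols, fnormSq_eq_trace, firstCols_gram _ hn (fun j => σ j ^ 2) (svd_gram h),
    Matrix.trace_diagonal, Finset.sum_range]

theorem svd_fnormSq {b a : ℕ} {X : Matrix (Fin b) (Fin a) ℝ}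
    {U : Matrix (Fin b) (Fin b) ℝ}
    {V : Matrix (Fin a) (Fin a) ℝ} {σ : ℕ → ℝ} (h : IsSVD X U V σ) :
    fnormSq X = ∑ i ∈ Finset.range a, σ i ^ 2 := by
  have h1 := pyth_right V h.2.2.2.1 X
  rw [Matrix.mul_assoc, h.2.2.1, Matrix.mul_one, sub_self] at h1
  have h2 := svd_fnormSq_firstCols h (le_refl a)
  have h3 : firstCols V (le_refl a) = V := by ext i j; simp [firstCols]
  rw [h3] at h2
  rw [← h2]
  have : fnormSq (0 : Matrix (Fin b) (Fin a) ℝ) = 0 := by simp [fnormSq]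
  linarith

theorem dot_gram {m n : ℕ} (N : Matrix (Fin m) (Fin n) ℝ) (d : Fin n → ℝ)
    (h : Nᵀ * N = Matrix.diagonal d) (z : Fin n → ℝ) :
    (N *ᵥ z) ⬝ᵥ (N *ᵥ z) = ∑ j, d j * z j ^ 2 := by
  rw [Matrix.dotProduct_mulVec, Matrix.vecMul_mulVec, ← Matrix.dotProduct_mulVec, h]
  simp only [dotProduct, Matrix.mulVec_diagonal]
  exact Finset.sum_congr rfl fun i _ => by ring

theorem dot_isom {m n : ℕ} (N : Matrix (Fin m) (Fin n) ℝ)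
    (h : Nᵀ * N = 1) (z : Fin n → ℝ) :
    (N *ᵥ z) ⬝ᵥ (N *ᵥ z) = z ⬝ᵥ z := by
  rw [dot_gram N (fun _ => 1) (by rw [h]; exact Matrix.diagonal_one.symm)]
  simp [dotProduct, sq]

/-- min-max type lemma -/
theorem svd_lower {b a i : ℕ} {X : Matrix (Fin b) (Fin a) ℝ}
    {U : Matrix (Fin b) (Fin b) ℝ}
    {V : Matrix (Fin a) (Fin a) ℝ} {σ : ℕ → ℝ} (h : IsSVD X U V σ) (hi : i < a)
    (L : Matrix (Fin i) (Fin a) ℝ) :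
    ∃ x : Fin a → ℝ, 0 < x ⬝ᵥ x ∧ L *ᵥ x = 0 ∧
      σ i ^ 2 * (x ⬝ᵥ x) ≤ (X *ᵥ x) ⬝ᵥ (X *ᵥ x) := by
  have hi' : i + 1 ≤ a := hi
  have hk : LinearMap.ker (Matrix.mulVecLin (L * firstCols V hi')) ≠ ⊥ :=
    LinearMap.ker_ne_bot_of_finrank_lt (by simp)
  obtain ⟨z, hz, hz0⟩ := Submodule.exists_mem_ne_zero_of_ne_bot hk
  rw [LinearMap.mem_ker, Matrix.mulVecLin_apply, ← Matrix.mulVec_mulVec] at hz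
  have hxx : (firstCols V hi' *ᵥ z) ⬝ᵥ (firstCols V hi' *ᵥ z) = z ⬝ᵥ z :=
    dot_isom _ (firstCols_orth V hi' h.2.2.2.1) z
  refine ⟨firstCols V hi' *ᵥ z, ?_, hz, ?_⟩
  · rw [hxx]
    refine lt_of_le_of_ne ?_ (fun h => hz0 (dotProduct_self_eq_zero.mp h.symm))
    exact Finset.sum_nonneg fun i _ => mul_self_nonneg _
  · rw [hxx, Matrix.mulVec_mulVec, mul_firstCols,
      dot_gram _ _ (firstCols_gram _ hi' (fun j => σ j ^ 2) (svd_gram h))]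
    simp only [dotProduct, Finset.mul_sum]
    refine Finset.sum_le_sum fun j _ => ?_
    rw [← sq]
    have h1 : σ i ≤ σ j := h.2.2.2.2.1 j i (by omega)
    have h2 := h.2.2.2.2.2.1 i
    gcongr

theorem svd_upper {b a i : ℕ} {X : Matrix (Fin b) (Fin a) ℝ}
    {U : Matrix (Fin b) (Fin b) ℝ}
    {V : Matrix (Fin a) (Fin a) ℝ} {σ : ℕ → ℝ} (h : IsSVD X U V σ) (hi : i < a)
    (x : Fin a → ℝ) (hx : (firstCols V hi.le)ᵀ *ᵥ x = 0) :
    (X *ᵥ x) ⬝ᵥ (X *ᵥ x) ≤ σ i ^ 2 * (x ⬝ᵥ x) := by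
  obtain ⟨w, rfl⟩ : ∃ w, x = V *ᵥ w := ⟨Vᵀ *ᵥ x, by
    rw [Matrix.mulVec_mulVec, h.2.2.1, Matrix.one_mulVec]⟩
  have hw : ∀ j : Fin a, (j : ℕ) < i → w j = 0 := by
    intro j hj
    have h1 : Vᵀ *ᵥ (V *ᵥ w) = w := by
      rw [Matrix.mulVec_mulVec, h.2.2.2.1, Matrix.one_mulVec]
    have h2 := congrFun hx ⟨j, hj⟩
    rw [← h1]
    simpa [Matrix.mulVec, dotProduct, firstCols] using h2
  rw [dot_isom V h.2.2.2.1, Matrix.mulVec_mulVec, dot_gram _ _ (svd_gram h)]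
  simp only [dotProduct, Finset.mul_sum]
  refine Finset.sum_le_sum fun j _ => ?_
  rw [← sq]
  by_cases hj : (j : ℕ) < i
  · simp [hw j hj]
  · have h1 : σ j ≤ σ i := h.2.2.2.2.1 i j (by omega)
    have h2 := h.2.2.2.2.2.1 j
    gcongr

theorem det_bound {a b r k : ℕ} (hra : r ≤ a) (hrk : r ≤ k)
    (M : Matrix (Fin b) (Fin a) ℝ)
    {UM : Matrix (Fin b) (Fin b) ℝ} {VM : Matrix (Fin a) (Fin a) ℝ} {σM : ℕ → ℝ}
    (hM : IsSVD M UM VM σM) (B : Matrix (Fin b) (Fin k) ℝ) (hB : Bᵀ * B = 1)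
    (c : ℝ) (hc : 0 < c)
    {U : Matrix (Fin b) (Fin b) ℝ} {V : Matrix (Fin a) (Fin a) ℝ} {σ : ℕ → ℝ}
    (hX : IsSVD (c • (B * (Bᵀ * M))) U V σ) :
    fnormSq (M * firstCols V hra * (firstCols V hra)ᵀ - M) ≤
      (∑ i ∈ Finset.Ico r k, σM i ^ 2) + (fnormSq M - fnormSq (Bᵀ * M)) := by
  set A := firstCols V hra with hA
  have hAA : Aᵀ * A = 1 := firstCols_orth V hra hX.2.2.2.1
  set X := c • (B * (Bᵀ * M)) with hXdef
  have hdot : ∀ x : Fin a → ℝ, (X *ᵥ x) ⬝ᵥ (X *ᵥ x) =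
      c ^ 2 * ((Bᵀ *ᵥ (M *ᵥ x)) ⬝ᵥ (Bᵀ *ᵥ (M *ᵥ x))) := by
    intro x
    rw [hXdef, Matrix.smul_mulVec, ← Matrix.mulVec_mulVec, ← Matrix.mulVec_mulVec,
      smul_dotProduct, dotProduct_smul, dot_isom B hB, smul_eq_mul, smul_eq_mul]
    ring
  have hproj : ∀ y : Fin b → ℝ, (Bᵀ *ᵥ y) ⬝ᵥ (Bᵀ *ᵥ y) ≤ y ⬝ᵥ y := by
    intro y
    have h0 : 0 ≤ (y - B *ᵥ (Bᵀ *ᵥ y)) ⬝ᵥ (y - B *ᵥ (Bᵀ *ᵥ y)) :=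
      Finset.sum_nonneg fun i _ => mul_self_nonneg _
    have h1 : y ⬝ᵥ (B *ᵥ (Bᵀ *ᵥ y)) = (Bᵀ *ᵥ y) ⬝ᵥ (Bᵀ *ᵥ y) := by
      rw [Matrix.dotProduct_mulVec, ← Matrix.mulVec_transpose]
    rw [sub_dotProduct, dotProduct_sub, dotProduct_sub, dot_isom B hB,
      dotProduct_comm (B *ᵥ _) y, h1] at h0
    linarith
  have hw : ∀ i, i < a → σ i ^ 2 ≤ c ^ 2 * σM i ^ 2 := by
    intro i hi
    obtain ⟨x, hx, hL, hle⟩ := svd_lower hX hi (firstCols VM hi.le)ᵀ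
    have h2 := svd_upper hM hi x hL
    rw [hdot] at hle
    have h3 := hproj (M *ᵥ x)
    have hc2 : 0 ≤ c ^ 2 := sq_nonneg c
    refine le_of_mul_le_mul_right (hle.trans ?_) hx
    rw [mul_assoc]
    exact mul_le_mul_of_nonneg_left (h3.trans h2) hc2
  have hz : ∀ i, i < a → k ≤ i → σ i = 0 := by
    intro i hi hki
    obtain ⟨x, hx, hL, hle⟩ := svd_lower hX (lt_of_le_of_lt hki hi) (Bᵀ * M)
    rw [hdot, Matrix.mulVec_mulVec, hL] at hle
    simp only [dotProduct_zero, mul_zero] at hle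
    have h1 : σ k ^ 2 ≤ 0 := by
      by_contra hcon
      push Not at hcon
      have := mul_pos hcon hx
      linarith
    have h2 : σ k = 0 := by nlinarith [hX.2.2.2.2.2.1 k]
    exact le_antisymm (h2 ▸ hX.2.2.2.2.1 k i hki) (hX.2.2.2.2.2.1 i)
  -- the truncated part
  have hXA : fnormSq (X - X * A * Aᵀ) ≤ c ^ 2 * ∑ i ∈ Finset.Ico r k, σM i ^ 2 := by
    rw [pyth_right A hAA, svd_fnormSq hX, hA, svd_fnormSq_firstCols hX hra,
      ← Finset.sum_Ico_eq_sub _ hra, Finset.mul_sum]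
    have e : ∑ i ∈ Finset.Ico r a, σ i ^ 2 = ∑ i ∈ Finset.Ico r (min a k), σ i ^ 2 := by
      symm
      apply Finset.sum_subset
      · intro i; simp only [Finset.mem_Ico]; omega
      · intro i h1 h2
        simp only [Finset.mem_Ico] at h1 h2
        rw [hz i h1.2 (by omega)]; simp
    rw [e]
    calc _ ≤ ∑ i ∈ Finset.Ico r (min a k), c ^ 2 * σM i ^ 2 := by
          refine Finset.sum_le_sum fun i hi => hw i ?_
          simp only [Finset.mem_Ico] at hi; omega
      _ ≤ _ := by
          apply Finset.sum_le_sum_of_subset_of_nonneg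
          · intro i; simp only [Finset.mem_Ico]; omega
          · intros; positivity
  set N := M - M * A * Aᵀ with hN
  have hXN : X - X * A * Aᵀ = c • (B * (Bᵀ * N)) := by
    rw [hXdef, hN]
    simp only [Matrix.mul_sub, smul_sub, Matrix.smul_mul, Matrix.mul_assoc]
  rw [hXN, fnormSq_smul, fnormSq_isom B hB] at hXA
  have hXA' := le_of_mul_le_mul_left hXA (by positivity)
  have e1 := pyth_left B hB N
  set R := M - B * (Bᵀ * M) with hR
  have e2 : N - B * (Bᵀ * N) = R - R * A * Aᵀ := by
    rw [hN, hR]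
    simp only [Matrix.mul_sub, Matrix.sub_mul, Matrix.mul_assoc]
    abel
  have e3 := pyth_right A hAA R
  have e4 := pyth_left B hB M
  have e5 : fnormSq (M * A * Aᵀ - M) = fnormSq N := by
    rw [hN, ← neg_sub, ← neg_one_smul ℝ, fnormSq_smul]; simp
  rw [← hR] at e4
  rw [e2] at e1
  have := fnormSq_nonneg (R * A)
  rw [e5]
  linarith

/-- solution of the left-sketch flow -/
theorem lsi_solution {a b k : ℕ} (hk : 0 < k) (α η : ℝ) (hα : 0 < α)
    (M : Matrix (Fin b) (Fin a) ℝ)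
    (A : ℝ → Matrix (Fin a) (Fin k) ℝ) (B : ℝ → Matrix (Fin b) (Fin k) ℝ)
    (hB : (B 0)ᵀ * B 0 = 1) (hA0 : A 0 = 0) (hf : LoraFlow α η 0 M A B) (t : ℝ) (ht : 0 ≤ t) :
    lX α (A t) (B t) =
      (1 - Real.exp (-(η * (α / k) ^ 2) * t)) • (B 0 * ((B 0)ᵀ * M)) := by
  have hkR : (0 : ℝ) < k := by exact_mod_cast hk
  have hak : α / (k : ℝ) ≠ 0 := (div_pos hα hkR).ne'
  have hBc : ∀ s, 0 ≤ s → B s = B 0 := by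
    intro s hs
    ext i j
    have := ode_scalar (fun s => B s i j) 0 0
      (fun s hs => by simpa using (hf s hs).2 i j) s hs
    simpa using this
  have hAt : A t = ((k / α) * (1 - Real.exp (-(η * (α / k) ^ 2) * t))) • (Mᵀ * B 0) := by
    ext i j
    have := ode_scalar (fun s => A s i j) (η * (α / k) ^ 2) ((k / α) * (Mᵀ * B 0) i j)
      (fun s hs => by
        have h := (hf s hs).1 i j
        rw [hBc s hs] at h
        have e : (lG α M (A s) (B 0))ᵀ * B 0 = (α / k) • ((α / k) • A s - Mᵀ * B 0) := by
          simp only [lG, lX, Matrix.transpose_smul, Matrix.transpose_sub, Matrix.transpose_mul,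
            Matrix.transpose_transpose, Matrix.smul_mul, Matrix.sub_mul, Matrix.mul_assoc, hB,
            Matrix.mul_one]
        rw [e] at h
        convert h using 1
        simp only [Matrix.smul_apply, Matrix.sub_apply, smul_eq_mul]
        field_simp) t ht
    simp only [hA0, Matrix.zero_apply] at this
    rw [this]
    simp only [Matrix.smul_apply, smul_eq_mul]
    ring
  rw [lX, hBc t ht, hAt, Matrix.transpose_smul, Matrix.transpose_mul, Matrix.transpose_transpose,
    Matrix.mul_smul, smul_smul]
  congr 1
  field_simp

/-- limit of the right-sketch flow -/
theorem rsi_limit {a b r : ℕ} (hr : 0 < r) (α η : ℝ) (hα : 0 < α) (hη : 0 < η)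
    (M : Matrix (Fin b) (Fin a) ℝ)
    (A : ℝ → Matrix (Fin a) (Fin r) ℝ) (B : ℝ → Matrix (Fin b) (Fin r) ℝ)
    (hA : (A 0)ᵀ * A 0 = 1) (hB0 : B 0 = 0) (hf : LoraFlow α 0 η M A B) (i : Fin b) (j : Fin a) :
    Tendsto (fun s => lX α (A s) (B s) i j) atTop (𝓝 ((M * A 0 * (A 0)ᵀ) i j)) := by
  have hrR : (0 : ℝ) < r := by exact_mod_cast hr
  have har : α / (r : ℝ) ≠ 0 := (div_pos hα hrR).ne'
  have hAc : ∀ s, 0 ≤ s → A s = A 0 := by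
    intro s hs
    ext i j
    have := ode_scalar (fun s => A s i j) 0 0
      (fun s hs => by simpa using (hf s hs).1 i j) s hs
    simpa using this
  have hBt : ∀ t, 0 ≤ t → B t = ((r / α) * (1 - Real.exp (-(η * (α / r) ^ 2) * t))) • (M * A 0) := by
    intro t ht
    ext i j
    have := ode_scalar (fun s => B s i j) (η * (α / r) ^ 2) ((r / α) * (M * A 0) i j)
      (fun s hs => by
        have h := (hf s hs).2 i j
        rw [hAc s hs] at h
        have e : lG α M (A 0) (B s) * A 0 = (α / r) • ((α / r) • B s - M * A 0) := by
          simp only [lG, lX, Matrix.smul_mul, Matrix.sub_mul, Matrix.mul_assoc, hA,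
            Matrix.mul_one]
        rw [e] at h
        convert h using 1
        simp only [Matrix.smul_apply, Matrix.sub_apply, smul_eq_mul]
        field_simp) t ht
    simp only [hB0, Matrix.zero_apply] at this
    rw [this]
    simp only [Matrix.smul_apply, smul_eq_mul]
    ring
  have hlim : Tendsto (fun s : ℝ => (1 - Real.exp (-(η * (α / r) ^ 2) * s)) *
      (M * A 0 * (A 0)ᵀ) i j) atTop (𝓝 ((1 - 0) * (M * A 0 * (A 0)ᵀ) i j)) := by
    refine Tendsto.mul_const _ (Tendsto.const_sub _ ?_)
    refine Real.tendsto_exp_atBot.comp ?_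
    refine Tendsto.const_mul_atTop_of_neg ?_ tendsto_id
    have : 0 < η * (α / r) ^ 2 := by positivity
    linarith
  rw [sub_zero, one_mul] at hlim
  refine hlim.congr' ?_
  filter_upwards [eventually_ge_atTop 0] with s hs
  rw [lX, hAc s hs, hBt s hs]
  simp only [Matrix.smul_mul, Matrix.smul_apply, smul_eq_mul]
  field_simp

theorem meas_entry {m n : Type*} (i : m) (j : n) : Measurable (fun N : Matrix m n ℝ => N i j) :=
  (measurable_pi_apply j).comp (measurable_pi_apply (X := fun _ : m => n → ℝ) i)

section haar
variable {b : ℕ} {Ω : Type*} [MeasurableSpace Ω] (μ : Measure Ω) [IsProbabilityMeasure μ]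
    (Uhat : Ω → Matrix (Fin b) (Fin b) ℝ) (hUmeas : Measurable Uhat)
    (hUorth : ∀ ω, Uhat ω * (Uhat ω)ᵀ = 1)
    (hUinv : ∀ Q : Matrix (Fin b) (Fin b) ℝ, Q * Qᵀ = 1 →
      Measure.map (fun ω => Q * Uhat ω) μ = Measure.map Uhat μ)

theorem entry_bound (U : Matrix (Fin b) (Fin b) ℝ) (hU : U * Uᵀ = 1) (i j : Fin b) :
    |U i j| ≤ 1 := by
  have h := congrFun (congrFun hU i) i
  simp only [Matrix.mul_apply, Matrix.transpose_apply, Matrix.one_apply_eq] at h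
  have h2 := Finset.single_le_sum (f := fun j => U i j * U i j)
    (fun j _ => mul_self_nonneg _) (Finset.mem_univ j)
  rw [h] at h2
  rw [← sq_le_one_iff_abs_le_one, sq]
  exact h2

theorem prod_integrable (hUmeas : Measurable Uhat) (hUorth : ∀ ω, Uhat ω * (Uhat ω)ᵀ = 1)
    (i l j : Fin b) : Integrable (fun ω => Uhat ω i j * Uhat ω l j) μ := by
  refine Integrable.of_bound (C := 1) ?_ ?_
  · exact (((meas_entry i j).comp hUmeas).mul ((meas_entry l j).comp hUmeas)).aestronglyMeasurable
  · refine Eventually.of_forall fun ω => ?_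
    rw [Real.norm_eq_abs, abs_mul]
    exact mul_le_one₀ (entry_bound _ (hUorth ω) i j) (abs_nonneg _) (entry_bound _ (hUorth ω) l j)

theorem inv_integral (hUmeas : Measurable Uhat)
    (hUinv : ∀ Q : Matrix (Fin b) (Fin b) ℝ, Q * Qᵀ = 1 →
      Measure.map (fun ω => Q * Uhat ω) μ = Measure.map Uhat μ)
    (Q : Matrix (Fin b) (Fin b) ℝ) (hQ : Q * Qᵀ = 1) (i l j : Fin b) :
    ∫ ω, (Q * Uhat ω) i j * (Q * Uhat ω) l j ∂μ = ∫ ω, Uhat ω i j * Uhat ω l j ∂μ := by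
  have hg : Measurable (fun N : Matrix (Fin b) (Fin b) ℝ => N i j * N l j) :=
    (meas_entry i j).mul (meas_entry l j)
  have hQm : Measurable (fun ω => Q * Uhat ω) := by
    refine measurable_pi_lambda _ fun p => measurable_pi_lambda _ fun q => ?_
    simp only [Matrix.mul_apply]
    exact Finset.measurable_sum _ fun x _ =>
      ((meas_entry x q).comp hUmeas).const_mul (Q p x)
  rw [← integral_map (f := fun N : Matrix (Fin b) (Fin b) ℝ => N i j * N l j)
      hQm.aemeasurable hg.aestronglyMeasurable, hUinv Q hQ,
    integral_map hUmeas.aemeasurable hg.aestronglyMeasurable]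

theorem second_moment (hUmeas : Measurable Uhat)
    (hUorth : ∀ ω, Uhat ω * (Uhat ω)ᵀ = 1)
    (hUinv : ∀ Q : Matrix (Fin b) (Fin b) ℝ, Q * Qᵀ = 1 →
      Measure.map (fun ω => Q * Uhat ω) μ = Measure.map Uhat μ) (i l j : Fin b) :
    ∫ ω, Uhat ω i j * Uhat ω l j ∂μ = if i = l then 1 / (b : ℝ) else 0 := by
  split_ifs with hil
  · subst hil
    have hall : ∀ p, ∫ ω, Uhat ω p j * Uhat ω p j ∂μ = ∫ ω, Uhat ω i j * Uhat ω i j ∂μ := by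
      intro p
      let e : Equiv.Perm (Fin b) := Equiv.swap i p
      have hQ : (e.permMatrix ℝ) * (e.permMatrix ℝ)ᵀ = 1 := by
        rw [Matrix.transpose_permMatrix, ← Matrix.permMatrix_mul]
        simp
      have := inv_integral μ Uhat hUmeas hUinv (e.permMatrix ℝ) hQ i i j
      simpa [Equiv.Perm.permMatrix, PEquiv.toMatrix_toPEquiv_mul, e] using this
    have hs : ∑ p, ∫ ω, Uhat ω p j * Uhat ω p j ∂μ = 1 := by
      rw [← integral_finsetSum _ (fun p _ => prod_integrable μ Uhat hUmeas hUorth p p j)]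
      have : ∀ ω, ∑ p, Uhat ω p j * Uhat ω p j = 1 := by
        intro ω
        have h0 : (Uhat ω)ᵀ * Uhat ω = 1 := mul_eq_one_comm.mp (hUorth ω)
        have h := congrFun (congrFun h0 j) j
        simpa [Matrix.mul_apply] using h
      simp [this]
    simp only [hall, Finset.sum_const, Finset.card_univ, Fintype.card_fin, nsmul_eq_mul] at hs
    have hb : (b : ℝ) ≠ 0 := by
      intro h0; rw [h0] at hs; simp at hs
    rw [eq_div_iff hb, mul_comm]
    exact hs
  · let d : Fin b → ℝ := fun p => if p = i then -1 else 1
    have hQ : Matrix.diagonal d * (Matrix.diagonal d)ᵀ = 1 := by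
      rw [Matrix.diagonal_transpose, Matrix.diagonal_mul_diagonal, ← Matrix.diagonal_one]
      congr 1
      funext p
      simp only [d]; split_ifs <;> norm_num
    have := inv_integral μ Uhat hUmeas hUinv _ hQ i l j
    simp only [Matrix.diagonal_mul, d, if_true, if_neg (Ne.symm hil), one_mul, neg_mul,
      integral_neg] at this
    linarith

theorem proj_expect {a k : ℕ} (hkb : k ≤ b) (M : Matrix (Fin b) (Fin a) ℝ)
    (hUmeas : Measurable Uhat)
    (hUorth : ∀ ω, Uhat ω * (Uhat ω)ᵀ = 1)
    (hUinv : ∀ Q : Matrix (Fin b) (Fin b) ℝ, Q * Qᵀ = 1 →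
      Measure.map (fun ω => Q * Uhat ω) μ = Measure.map Uhat μ) :
    Integrable (fun ω => fnormSq ((firstCols (Uhat ω) hkb)ᵀ * M)) μ ∧
    ∫ ω, fnormSq ((firstCols (Uhat ω) hkb)ᵀ * M) ∂μ = (k : ℝ) / b * fnormSq M := by
  have e : ∀ ω, fnormSq ((firstCols (Uhat ω) hkb)ᵀ * M) =
      ∑ j : Fin k, ∑ c : Fin a, ∑ i : Fin b, ∑ l : Fin b,
        (Uhat ω i (Fin.castLE hkb j) * Uhat ω l (Fin.castLE hkb j)) * (M i c * M l c) := by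
    intro ω
    simp only [fnormSq, Matrix.mul_apply, Matrix.transpose_apply, firstCols, Matrix.of_apply, sq,
      Finset.sum_mul_sum]
    refine Finset.sum_congr rfl fun j _ => Finset.sum_congr rfl fun c _ =>
      Finset.sum_congr rfl fun i _ => Finset.sum_congr rfl fun l _ => by ring
  have hI := fun (j : Fin k) (c : Fin a) (i l : Fin b) =>
    (prod_integrable μ Uhat hUmeas hUorth i l (Fin.castLE hkb j)).mul_const (M i c * M l c)
  have hI2 := fun (j : Fin k) (c : Fin a) (i : Fin b) =>
    integrable_finsetSum Finset.univ (fun l _ => hI j c i l)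
  have hI3 := fun (j : Fin k) (c : Fin a) =>
    integrable_finsetSum Finset.univ (fun i _ => hI2 j c i)
  have hI4 := fun (j : Fin k) =>
    integrable_finsetSum Finset.univ (fun c _ => hI3 j c)
  simp only [e]
  refine ⟨integrable_finsetSum Finset.univ (fun j _ => hI4 j), ?_⟩
  rw [integral_finsetSum _ (fun j _ => hI4 j)]
  have : ∀ j : Fin k, ∫ ω, ∑ c : Fin a, ∑ i : Fin b, ∑ l : Fin b,
        (Uhat ω i (Fin.castLE hkb j) * Uhat ω l (Fin.castLE hkb j)) * (M i c * M l c) ∂μ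
        = 1 / (b : ℝ) * fnormSq M := by
    intro j
    rw [integral_finsetSum _ (fun c _ => hI3 j c), fnormSq, Finset.sum_comm, Finset.mul_sum]
    refine Finset.sum_congr rfl fun c _ => ?_
    rw [integral_finsetSum _ (fun i _ => hI2 j c i), Finset.mul_sum]
    refine Finset.sum_congr rfl fun i _ => ?_
    rw [integral_finsetSum _ (fun l _ => hI j c i l)]
    simp only [integral_mul_const, second_moment μ Uhat hUmeas hUorth hUinv]
    simp [sq]
  simp only [this, Finset.sum_const, Finset.card_univ, Fintype.card_fin, nsmul_eq_mul]
  ring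

end haar

/-- **High-Rank Preheating.** Let `Û` be a Haar-random `b × b` orthogonal matrix
(modeled as a random orthogonal matrix whose law is invariant under left multiplication by
every fixed orthogonal matrix), let `B̂₀` consist of its first `k` columns (`r ≤ k ≤ b`), and
run the rank-`k` Asymmetric LoRA gradient flow with LSI (`Â₀ = 0`, `B̂₀` frozen) up to an
arbitrary time `t > 0`, producing `X̂ₜ = (α/k) B̂ₜ Âₜᵀ`. Assume almost surely
`σ_r(X̂ₜ) > σ_{r+1}(X̂ₜ)`, and let `A₀` have columns equal to orthonormal right singular
vectors of `X̂ₜ` for its `r` largest singular values (the first `r` columns of the `V`-factor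
of an SVD of `X̂ₜ`). Then the rank-`r` Asymmetric LoRA flow with RSI initialized at this `A₀`
(`B₀ = 0`) converges as `s → ∞` to a limit `X_∞` with
`E[(1/2)‖X_∞ - M‖_F²] ≤ Σ_{i=r+1}^{k} σᵢ(M)² + ((b-k)/(2b)) Σ_{i=1}^{min(a,b)} σᵢ(M)²`. -/
theorem statement5
    (a b r k : ℕ) (ha : 0 < a) (hb : 0 < b) (hr0 : 0 < r) (hr : r ≤ min a b)
    (hrk : r ≤ k) (hkb : k ≤ b)
    (α η : ℝ) (hα : 0 < α) (hη : 0 < η)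
    (M : Matrix (Fin b) (Fin a) ℝ)
    (UM : Matrix (Fin b) (Fin b) ℝ) (VM : Matrix (Fin a) (Fin a) ℝ) (σM : ℕ → ℝ)
    (hsvdM : IsSVD M UM VM σM)
    {Ω : Type*} [MeasurableSpace Ω] (μ : Measure Ω) [IsProbabilityMeasure μ]
    -- `Û`: Haar-random orthogonal matrix
    (Uhat : Ω → Matrix (Fin b) (Fin b) ℝ) (hUmeas : Measurable Uhat)
    (hUorth : ∀ ω, Uhat ω * (Uhat ω)ᵀ = 1)
    (hUinv : ∀ Q : Matrix (Fin b) (Fin b) ℝ, Q * Qᵀ = 1 →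
      Measure.map (fun ω => Q * Uhat ω) μ = Measure.map Uhat μ)
    -- frozen preheating adapter: first `k` columns of `Û`
    (Bhat0 : Ω → Matrix (Fin b) (Fin k) ℝ)
    (hBhat0 : ∀ ω, Bhat0 ω = Matrix.of (fun i j => Uhat ω i (Fin.castLE hkb j)))
    -- rank-`k` preheating flow (LSI: `Â₀ = 0`, `B̂` frozen)
    (Ahat : Ω → ℝ → Matrix (Fin a) (Fin k) ℝ)
    (Bhat : Ω → ℝ → Matrix (Fin b) (Fin k) ℝ)
    (hhat0 : ∀ ω, Ahat ω 0 = 0 ∧ Bhat ω 0 = Bhat0 ω)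
    (hhatflow : ∀ ω, LoraFlow α η 0 M (Ahat ω) (Bhat ω))
    -- the preheating time
    (t : ℝ) (ht : 0 < t)
    -- an SVD of the preheated matrix `X̂ₜ`
    (UX : Ω → Matrix (Fin b) (Fin b) ℝ) (VX : Ω → Matrix (Fin a) (Fin a) ℝ) (σX : Ω → ℕ → ℝ)
    (hsvdX : ∀ ω, IsSVD (lX α (Ahat ω t) (Bhat ω t)) (UX ω) (VX ω) (σX ω))
    -- almost sure spectral gap `σ_r(X̂ₜ) > σ_{r+1}(X̂ₜ)` (`0`-based: `σX (r-1) > σX r`)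
    (hgap : ∀ᵐ ω ∂μ, σX ω r < σX ω (r - 1))
    -- HRP initialization: first `r` right singular vectors of `X̂ₜ`
    (A0 : Ω → Matrix (Fin a) (Fin r) ℝ)
    (hA0 : ∀ ω, A0 ω =
      Matrix.of (fun i j => VX ω i (Fin.castLE (hr.trans (min_le_left a b)) j)))
    -- rank-`r` main flow (RSI: `B₀ = 0`, `A` frozen at `A₀`)
    (A2 : Ω → ℝ → Matrix (Fin a) (Fin r) ℝ) (B2 : Ω → ℝ → Matrix (Fin b) (Fin r) ℝ)
    (h20 : ∀ ω, A2 ω 0 = A0 ω ∧ B2 ω 0 = 0)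
    (h2flow : ∀ ω, LoraFlow α 0 η M (A2 ω) (B2 ω)) :
    ∃ Xinf : Ω → Matrix (Fin b) (Fin a) ℝ,
      (∀ ω, ∀ i j, Tendsto (fun s => lX α (A2 ω s) (B2 ω s) i j) atTop (𝓝 (Xinf ω i j))) ∧
      ∫ ω, (1 / 2) * fnormSq (Xinf ω - M) ∂μ ≤
        (∑ i ∈ Finset.Ico r k, σM i ^ 2) +
          ((b : ℝ) - k) / (2 * b) * ∑ i ∈ Finset.range (min a b), σM i ^ 2 := by
  have hk0 : 0 < k := lt_of_lt_of_le hr0 hrk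
  have hra : r ≤ a := hr.trans (min_le_left a b)
  have hbR : (0 : ℝ) < b := by exact_mod_cast hb
  have hkR : (0 : ℝ) < k := by exact_mod_cast hk0
  have hB : ∀ ω, Bhat ω 0 = firstCols (Uhat ω) hkb := fun ω => by
    rw [(hhat0 ω).2, hBhat0 ω]; rfl
  have hBB : ∀ ω, (Bhat ω 0)ᵀ * Bhat ω 0 = 1 := fun ω => by
    rw [hB]; exact firstCols_orth _ _ (mul_eq_one_comm.mp (hUorth ω))
  have hA : ∀ ω, A2 ω 0 = firstCols (VX ω) hra := fun ω => by
    rw [(h20 ω).1, hA0 ω]; rfl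
  have hAA : ∀ ω, (A2 ω 0)ᵀ * A2 ω 0 = 1 := fun ω => by
    rw [hA]; exact firstCols_orth _ _ (hsvdX ω).2.2.2.1
  refine ⟨fun ω => M * A2 ω 0 * (A2 ω 0)ᵀ, fun ω i j =>
    rsi_limit hr0 α η hα hη M (A2 ω) (B2 ω) (hAA ω) (h20 ω).2 (h2flow ω) i j, ?_⟩
  obtain ⟨hint, hval⟩ := proj_expect μ Uhat hkb M hUmeas hUorth hUinv
  set S := ∑ i ∈ Finset.Ico r k, σM i ^ 2 with hS
  have hS0 : 0 ≤ S := Finset.sum_nonneg fun _ _ => sq_nonneg _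
  have hbound : ∀ ω, (1 / 2) * fnormSq (M * A2 ω 0 * (A2 ω 0)ᵀ - M) ≤
      (S + 1 / 2 * fnormSq M) - 1 / 2 * fnormSq ((firstCols (Uhat ω) hkb)ᵀ * M) := by
    intro ω
    have hc : 0 < 1 - Real.exp (-(η * (α / k) ^ 2) * t) := by
      have h1 : 0 < η * (α / k) ^ 2 * t := by positivity
      have : Real.exp (-(η * (α / k) ^ 2) * t) < 1 := by
        rw [Real.exp_lt_one_iff]; linarith
      linarith
    have h1 := hsvdX ω
    rw [lsi_solution hk0 α η hα M (Ahat ω) (Bhat ω) (hBB ω) (hhat0 ω).1 (hhatflow ω) t ht.le] at h1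
    have h2 := det_bound hra hrk M hsvdM (Bhat ω 0) (hBB ω) _ hc h1
    rw [← hA ω, hB ω] at h2
    linarith
  have hint2 : Integrable (fun ω => (S + 1 / 2 * fnormSq M) -
      1 / 2 * fnormSq ((firstCols (Uhat ω) hkb)ᵀ * M)) μ :=
    (integrable_const _).sub (hint.const_mul _)
  refine (integral_mono_of_nonneg (Eventually.of_forall fun ω => ?_) hint2
    (Eventually.of_forall hbound)).trans (le_of_eq ?_)
  · exact mul_nonneg (by norm_num) (fnormSq_nonneg _)
  · rw [integral_sub (integrable_const _) (hint.const_mul _), integral_const_mul, hval]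
    have hM : fnormSq M = ∑ i ∈ Finset.range (min a b), σM i ^ 2 := by
      rw [svd_fnormSq hsvdM]
      symm
      apply Finset.sum_subset
      · intro i; simp only [Finset.mem_range]; omega
      · intro i _ h2
        simp only [Finset.mem_range, not_lt] at h2
        rw [hsvdM.2.2.2.2.2.2.1 i h2]; simp
    rw [← hM]
    simp only [integral_const, probReal_univ, one_smul]
    field_simp
    ring

end
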